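/- arXiv:1412.4076 — 2 statements merged into one kernel-verified Lean document; each statement's English description precedes it below -/
import Mathlib

section
/- For every integer k ≥ 2 there exists an optimal character f^k for d_MP(T^k_A, T^k_B) that uses exactly 3 states and for which there exist optimal extensions of f^k to T^k_A and to T^k_B (i.e. extensions attaining the respective parsimony scores) assigning the roots of T^k_A and T^k_B the same state. -/
namespace MPDist

/-- A rooted binary phylogenetic tree: leaves are labelled by taxa,
every internal vertex (including the root) has exactly two children. -/
inductive PTree (X : Type) : Type
  | leaf : X → PTree X
  | node : PTree X → PTree X → PTree X

namespace PTree

/-- The list of leaf labels (taxa) of a tree. -/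
def leaves {X : Type} : PTree X → List X
  | .leaf x => [x]
  | .node l r => l.leaves ++ r.leaves

/-- Relabelling of taxa. -/
def map {X Y : Type} (φ : X → Y) : PTree X → PTree Y
  | .leaf x => .leaf (φ x)
  | .node l r => .node (l.map φ) (r.map φ)

end PTree

/-- `T` is a phylogenetic tree on the taxon set `X`:
its leaves are bijectively labelled by the elements of `X`. -/
def IsPhylo {X : Type} (T : PTree X) : Prop :=
  T.leaves.Nodup ∧ ∀ x : X, x ∈ T.leaves

/-- A state-labelled binary tree (an extension assigns a state to every vertex). -/
inductive ETree (C : Type) : Type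
  | leaf : C → ETree C
  | node : C → ETree C → ETree C → ETree C

namespace ETree

/-- The state at the root. -/
def root {C : Type} : ETree C → C
  | .leaf c => c
  | .node c _ _ => c

/-- The number of edges `{u,v}` with different states at the two endpoints
(substitutions/mutations). -/
def changes {C : Type} [DecidableEq C] : ETree C → ℕ
  | .leaf _ => 0
  | .node c l r =>
      ((if l.root = c then 0 else 1) + (if r.root = c then 0 else 1)) +
        (l.changes + r.changes)

end ETree

/-- `g` is an extension of the character `f` to the tree `T`: it has the same
shape as `T`, assigns a state to every vertex, and agrees with `f` on the taxa. -/
inductive IsExtension {X C : Type} (f : X → C) : PTree X → ETree C → Prop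
  | leaf (x : X) : IsExtension f (.leaf x) (.leaf (f x))
  | node {l r : PTree X} {gl gr : ETree C} (c : C) :
      IsExtension f l gl → IsExtension f r gr →
      IsExtension f (.node l r) (.node c gl gr)

/-- The parsimony score `l_f(T)`: the minimum number of mutation edges
over all extensions of `f` to `T`. -/
noncomputable def pscore {X C : Type} [DecidableEq C] (f : X → C) (T : PTree X) : ℕ :=
  sInf { k : ℕ | ∃ g : ETree C, IsExtension f T g ∧ g.changes = k }

/-- The MP distance `d_MP(T1,T2) = max_f |l_f(T1) − l_f(T2)|`, the maximum taken
over all characters `f` on the taxon set (states drawn from `ℕ`). -/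
noncomputable def dMP {X : Type} (T1 T2 : PTree X) : ℕ :=
  sSup { k : ℕ | ∃ f : X → ℕ, k = ((pscore f T1 : ℤ) - (pscore f T2 : ℤ)).natAbs }

/-- `d^i_MP(T1,T2)`: as `dMP`, but over characters using at most `i` states. -/
noncomputable def dMPk {X : Type} (i : ℕ) (T1 T2 : PTree X) : ℕ :=
  sSup { k : ℕ | ∃ f : X → Fin i, k = ((pscore f T1 : ℤ) - (pscore f T2 : ℤ)).natAbs }

/-- `max_f (l_f(T2) − l_f(T1))` over all characters `f`. -/
noncomputable def maxDiff {X : Type} (T1 T2 : PTree X) : ℤ :=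
  sSup { d : ℤ | ∃ f : X → ℕ, d = (pscore f T2 : ℤ) - (pscore f T1 : ℤ) }

/-- `max_f (l_f(T2) − l_f(T1))` over all characters `f` with at most `i` states. -/
noncomputable def maxDiffk {X : Type} (i : ℕ) (T1 T2 : PTree X) : ℤ :=
  sSup { d : ℤ | ∃ f : X → Fin i, d = (pscore f T2 : ℤ) - (pscore f T1 : ℤ) }

/-- `gap(T1,T2) = |max_f(l_f(T2)−l_f(T1)) − max_f(l_f(T1)−l_f(T2))|`. -/
noncomputable def gap {X : Type} (T1 T2 : PTree X) : ℤ :=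
  |maxDiff T1 T2 - maxDiff T2 T1|

/-- `gap` restricted to characters with at most `i` states. -/
noncomputable def gapk {X : Type} (i : ℕ) (T1 T2 : PTree X) : ℤ :=
  |maxDiffk i T1 T2 - maxDiffk i T2 T1|

/-- `s` occurs as a (rooted) subtree of `t`. -/
inductive IsSubtree {X : Type} : PTree X → PTree X → Prop
  | refl (t : PTree X) : IsSubtree t t
  | left {s l r : PTree X} : IsSubtree s l → IsSubtree s (.node l r)
  | right {s l r : PTree X} : IsSubtree s r → IsSubtree s (.node l r)

/-- Taxa `a`, `b` form a cherry of `T`: they are leaves with a common parent. -/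
def IsCherry {X : Type} (T : PTree X) (a b : X) : Prop :=
  IsSubtree (.node (.leaf a) (.leaf b)) T

/-- Relabel a tree on taxa `ℕ` by shifting all labels up by `s` (fresh copies). -/
def shiftT (s : ℕ) (T : PTree ℕ) : PTree ℕ := T.map (fun x => x + s)

/-- `T_a = (((((2,3),4),5),6),1)` on taxa `{1,…,6}` (taxon `j` encoded as `j-1`). -/
def Ta6 : PTree ℕ :=
  .node (.node (.node (.node (.node (.leaf 1) (.leaf 2)) (.leaf 3)) (.leaf 4)) (.leaf 5)) (.leaf 0)

/-- `T_b = ((((2,6),(3,4)),5),1)` on taxa `{1,…,6}` (taxon `j` encoded as `j-1`). -/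
def Tb6 : PTree ℕ :=
  .node (.node (.node (.node (.leaf 1) (.leaf 5)) (.node (.leaf 2) (.leaf 3))) (.leaf 4)) (.leaf 0)

/-- `T_A`: two disjoint copies of `T_a` joined under a new root (12 taxa). -/
def TA12 : PTree ℕ := .node Ta6 (shiftT 6 Ta6)

/-- `T_B`: two disjoint copies of `T_b` joined under a new root (12 taxa). -/
def TB12 : PTree ℕ := .node Tb6 (shiftT 6 Tb6)

/-- `TkA k` is the tree `T^{k+1}_A`: `k+1` disjoint copies of `T_A` arranged
along a caterpillar backbone (so `TkA 0 = T^1_A = T_A`). -/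
def TkA : ℕ → PTree ℕ
  | 0 => TA12
  | k+1 => .node (TkA k) (shiftT (12*(k+1)) TA12)

/-- `TkB k` is the tree `T^{k+1}_B`. -/
def TkB : ℕ → PTree ℕ
  | 0 => TB12
  | k+1 => .node (TkB k) (shiftT (12*(k+1)) TB12)

/-- `T_a = (((5,(6,4)),3),((1,(8,2)),7))` on taxa `{1,…,8}` (taxon `j` encoded as `j-1`). -/
def Ta8 : PTree ℕ :=
  .node (.node (.node (.leaf 4) (.node (.leaf 5) (.leaf 3))) (.leaf 2))
        (.node (.node (.leaf 0) (.node (.leaf 7) (.leaf 1))) (.leaf 6))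

/-- `T_b = (((7,((4,2),6)),3),(8,(1,5)))` on taxa `{1,…,8}` (taxon `j` encoded as `j-1`). -/
def Tb8 : PTree ℕ :=
  .node (.node (.node (.leaf 6) (.node (.node (.leaf 3) (.leaf 1)) (.leaf 5))) (.leaf 2))
        (.node (.leaf 7) (.node (.leaf 0) (.leaf 4)))

/-- `T_A` (2-state construction): two disjoint copies of `T_a` under a new root (16 taxa). -/
def TA16 : PTree ℕ := .node Ta8 (shiftT 8 Ta8)

/-- `T_B` (2-state construction): two disjoint copies of `T_b` under a new root (16 taxa). -/
def TB16 : PTree ℕ := .node Tb8 (shiftT 8 Tb8)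

/-- `T_AA`: two disjoint copies of `T_A` under a new root (32 taxa). -/
def TAA : PTree ℕ := .node TA16 (shiftT 16 TA16)

/-- `T_BB`: two disjoint copies of `T_B` under a new root (32 taxa). -/
def TBB : PTree ℕ := .node TB16 (shiftT 16 TB16)

/-- `TkAA k` is the tree `T^{k+1}_AA` (so `TkAA 0 = T^1_AA = T_AA`). -/
def TkAA : ℕ → PTree ℕ
  | 0 => TAA
  | k+1 => .node (TkAA k) (shiftT (32*(k+1)) TAA)

/-- `TkBB k` is the tree `T^{k+1}_BB`. -/
def TkBB : ℕ → PTree ℕ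
  | 0 => TBB
  | k+1 => .node (TkBB k) (shiftT (32*(k+1)) TBB)


theorem isExt_map {X Y C : Type} (φ : X → Y) (f : Y → C) (T : PTree X) (g : ETree C) :
    IsExtension f (T.map φ) g ↔ IsExtension (fun x => f (φ x)) T g := by
  induction T generalizing g with
  | leaf x =>
    constructor
    · intro h; cases h; exact IsExtension.leaf (f := fun x => f (φ x)) x
    · intro h; cases h; exact IsExtension.leaf (f := f) (φ x)
  | node l r ihl ihr =>
    constructor
    · intro h
      cases h with
      | node c h1 h2 => exact .node c ((ihl _).1 h1) ((ihr _).1 h2)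
    · intro h
      cases h with
      | node c h1 h2 => exact .node c ((ihl _).2 h1) ((ihr _).2 h2)

theorem leaves_map' {X Y : Type} (φ : X → Y) (T : PTree X) :
    (T.map φ).leaves = T.leaves.map φ := by
  induction T with
  | leaf x => rfl
  | node l r ihl ihr => simp [PTree.map, PTree.leaves, ihl, ihr]

/-- Every extension of `T1` yields one of `T2` with the same root, at most `m` worse. -/
def Rel (m : ℕ) (T1 T2 : PTree ℕ) : Prop :=
  ∀ (f : ℕ → ℕ) (g : ETree ℕ), IsExtension f T1 g →
    ∃ g', IsExtension f T2 g' ∧ g'.root = g.root ∧ g'.changes ≤ g.changes + m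

theorem Rel.node {m n : ℕ} {l l' r r' : PTree ℕ} (h1 : Rel m l l') (h2 : Rel n r r') :
    Rel (m + n) (.node l r) (.node l' r') := by
  intro f g hg
  cases hg with
  | node c e1 e2 =>
    obtain ⟨a, ha, ra, ca⟩ := h1 f _ e1
    obtain ⟨b, hb, rb, cb⟩ := h2 f _ e2
    refine ⟨.node c a b, .node c ha hb, rfl, ?_⟩
    simp only [ETree.changes, ra, rb]
    omega

theorem Rel.shift {m s : ℕ} {l l' : PTree ℕ} (h : Rel m l l') :
    Rel m (shiftT s l) (shiftT s l') := by
  intro f g hg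
  obtain ⟨a, ha, ra, ca⟩ := h _ g ((isExt_map _ f l g).1 hg)
  exact ⟨a, (isExt_map _ f l' a).2 ha, ra, ca⟩

/-- Discrete metric. -/
def dd (x y : ℕ) : ℕ := if x = y then 0 else 1

theorem dd_le (x y : ℕ) : dd x y ≤ 1 := by unfold dd; split <;> omega
theorem dd_self (x : ℕ) : dd x x = 0 := by simp [dd]
theorem dd_comm (x y : ℕ) : dd x y = dd y x := by simp [dd, eq_comm]
theorem dd_tri (x y z : ℕ) : dd x z ≤ dd x y + dd y z := by
  unfold dd; split_ifs <;> omega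

theorem changes_node (c : ℕ) (l r : ETree ℕ) :
    (ETree.node c l r).changes = dd l.root c + dd r.root c + (l.changes + r.changes) := rfl

theorem changes_leaf (c : ℕ) : (ETree.leaf c).changes = 0 := rfl

theorem rel_ab : Rel 2 Ta6 Tb6 := by
  intro f g hg
  obtain _ | ⟨r, h4, h0⟩ := hg
  obtain _ | ⟨u4, h3, h5⟩ := h4
  obtain _ | ⟨u3, h2, h4⟩ := h3
  obtain _ | ⟨u2, h1, h3⟩ := h2
  obtain _ | ⟨u1, h1, h2⟩ := h1
  cases h0; cases h1; cases h2; cases h3; cases h4; cases h5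
  refine ⟨_, .node r (.node u3 (.node u2 (.node (f 1) (.leaf _) (.leaf _))
    (.node u2 (.leaf _) (.leaf _))) (.leaf _)) (.leaf _), rfl, ?_⟩
  simp only [changes_node, ETree.root, changes_leaf, dd_self]
  have := dd_tri u3 u4 r
  have := dd_tri (f 2) u1 u2
  have := dd_le (f 5) (f 1)
  have := dd_le (f 1) u2
  omega

theorem rel_ba : Rel 2 Tb6 Ta6 := by
  intro f g hg
  obtain _ | ⟨r, h4, h0⟩ := hg
  obtain _ | ⟨v4, h3, h4⟩ := h4
  obtain _ | ⟨v3, h1, h2⟩ := h3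
  obtain _ | ⟨v1, h1, h5⟩ := h1
  obtain _ | ⟨v2, h2, h3⟩ := h2
  cases h0; cases h1; cases h2; cases h3; cases h4; cases h5
  refine ⟨_, .node r (.node v4 (.node v4 (.node v3 (.node v3 (.leaf _) (.leaf _))
    (.leaf _)) (.leaf _)) (.leaf _)) (.leaf _), rfl, ?_⟩
  simp only [changes_node, ETree.root, changes_leaf, dd_self]
  have := dd_tri (f 1) v1 v3
  have := dd_tri (f 2) v2 v3
  have := dd_tri (f 3) v2 v3
  have := dd_le (f 5) v4
  have := dd_le v2 v3
  omega

theorem rel_AB (k : ℕ) : Rel (4 * (k + 1)) (TkA k) (TkB k) := by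
  have h0 : Rel 4 TA12 TB12 := rel_ab.node rel_ab.shift
  induction k with
  | zero => exact h0
  | succ k ih => exact ih.node h0.shift

theorem rel_BA (k : ℕ) : Rel (4 * (k + 1)) (TkB k) (TkA k) := by
  have h0 : Rel 4 TB12 TA12 := rel_ba.node rel_ba.shift
  induction k with
  | zero => exact h0
  | succ k ih => exact ih.node h0.shift

theorem exists_ext (f : ℕ → ℕ) (T : PTree ℕ) : ∃ g, IsExtension f T g := by
  induction T with
  | leaf x => exact ⟨_, .leaf x⟩
  | node l r ihl ihr =>
    obtain ⟨a, ha⟩ := ihl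
    obtain ⟨b, hb⟩ := ihr
    exact ⟨_, .node 0 ha hb⟩

theorem pscore_le (f : ℕ → ℕ) (T : PTree ℕ) (g : ETree ℕ) (h : IsExtension f T g) :
    pscore f T ≤ g.changes := Nat.sInf_le ⟨g, h, rfl⟩

theorem pscore_att (f : ℕ → ℕ) (T : PTree ℕ) :
    ∃ g, IsExtension f T g ∧ g.changes = pscore f T := by
  obtain ⟨g, hg⟩ := exists_ext f T
  exact Nat.sInf_mem (s := { k : ℕ | ∃ g : ETree ℕ, IsExtension f T g ∧ g.changes = k })
    ⟨_, g, hg, rfl⟩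

theorem Rel.pscore {m : ℕ} {T1 T2 : PTree ℕ} (h : Rel m T1 T2) (f : ℕ → ℕ) :
    pscore f T2 ≤ pscore f T1 + m := by
  obtain ⟨g, hg, e⟩ := pscore_att f T1
  obtain ⟨g', hg', -, c⟩ := h f g hg
  have := pscore_le f T2 g' hg'
  omega

/-- The optimal character. -/
def fc (x : ℕ) : ℕ :=
  if x % 6 = 0 ∨ x % 6 = 5 then 0 else if x % 6 ≤ 2 then 1 else 2

theorem fc_shift (s : ℕ) : (fun x => fc (x + 6 * s)) = fc := by
  funext x
  simp [fc]

theorem ext_shift (s : ℕ) (T : PTree ℕ) (g : ETree ℕ) :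
    IsExtension fc (shiftT (6 * s) T) g ↔ IsExtension fc T g := by
  unfold shiftT
  rw [isExt_map, fc_shift]

/-- Good extension with root state 0. -/
def Good (n : ℕ) (T : PTree ℕ) : Prop :=
  ∃ g, IsExtension fc T g ∧ g.root = 0 ∧ g.changes = n

theorem Good.node {m n : ℕ} {l r : PTree ℕ} (h1 : Good m l) (h2 : Good n r) :
    Good (m + n) (.node l r) := by
  obtain ⟨a, ha, ra, ca⟩ := h1
  obtain ⟨b, hb, rb, cb⟩ := h2
  exact ⟨_, .node 0 ha hb, rfl, by simp [ETree.changes, ra, rb, ca, cb]⟩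

theorem Good.shift {m : ℕ} (s : ℕ) {T : PTree ℕ} (h : Good m T) : Good m (shiftT (6 * s) T) := by
  obtain ⟨a, ha, r⟩ := h
  exact ⟨a, (ext_shift _ _ _).2 ha, r⟩

/-- Lower bound on all extensions. -/
def Low (n : ℕ) (T : PTree ℕ) : Prop := ∀ g, IsExtension fc T g → n ≤ g.changes

theorem Low.node {m n : ℕ} {l r : PTree ℕ} (h1 : Low m l) (h2 : Low n r) :
    Low (m + n) (.node l r) := by
  intro g hg
  cases hg with
  | node c e1 e2 =>
    have := h1 _ e1
    have := h2 _ e2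
    simp only [ETree.changes]
    omega

theorem Low.shift {m : ℕ} (s : ℕ) {T : PTree ℕ} (h : Low m T) : Low m (shiftT (6 * s) T) :=
  fun g hg => h g ((ext_shift _ _ _).1 hg)

theorem good_a : Good 2 Ta6 :=
  ⟨_, .node 0 (.node 0 (.node 2 (.node 2 (.node 1 (.leaf _) (.leaf _))
    (.leaf _)) (.leaf _)) (.leaf _)) (.leaf _), rfl, by
      simp [ETree.changes, ETree.root, fc]⟩

theorem low_b : Low 4 Tb6 := by
  intro g hg
  obtain _ | ⟨r, h4, h0⟩ := hg
  obtain _ | ⟨v4, h3, h4⟩ := h4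
  obtain _ | ⟨v3, h1, h2⟩ := h3
  obtain _ | ⟨v1, h1, h5⟩ := h1
  obtain _ | ⟨v2, h2, h3⟩ := h2
  cases h0; cases h1; cases h2; cases h3; cases h4; cases h5
  simp only [changes_node, ETree.root, changes_leaf]
  have e0 : fc 0 = 0 := rfl
  have e1 : fc 1 = 1 := rfl
  have e2 : fc 2 = 1 := rfl
  have e3 : fc 3 = 2 := rfl
  have e4 : fc 4 = 2 := rfl
  have e5 : fc 5 = 0 := rfl
  rw [e0, e1, e2, e3, e4, e5]
  -- bottom part: two changes, and a third unless `v3 = 1`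
  have A : 2 + dd 1 v3 ≤ dd 1 v1 + dd 0 v1 + dd 1 v2 + dd 2 v2 + dd v1 v3 + dd v2 v3 := by
    unfold dd; split_ifs <;> omega
  have B : 2 ≤ dd 1 v3 + dd v3 v4 + dd 2 v4 + dd v4 r + dd 0 r := by
    unfold dd; split_ifs <;> omega
  omega

theorem good_A (k : ℕ) : Good (4 * (k + 1)) (TkA k) := by
  have h0 : Good 4 TA12 := good_a.node (good_a.shift 1)
  induction k with
  | zero => exact h0
  | succ k ih =>
    have := ih.node (h0.shift (2 * (k + 1)))
    rw [← mul_assoc] at this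
    exact this

theorem low_B (k : ℕ) : Low (8 * (k + 1)) (TkB k) := by
  have h0 : Low 8 TB12 := low_b.node (low_b.shift 1)
  induction k with
  | zero => exact h0
  | succ k ih =>
    have := ih.node (h0.shift (2 * (k + 1)))
    rw [← mul_assoc] at this
    exact this

theorem states (k : ℕ) : ((TkA k).leaves.map fc).toFinset = {0, 1, 2} := by
  have h0 : (TA12.leaves.map fc).toFinset = {0, 1, 2} := by decide
  induction k with
  | zero => exact h0
  | succ k ih =>
    have h1 : ((shiftT (12 * (k + 1)) TA12).leaves.map fc) = TA12.leaves.map fc := by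
      unfold shiftT
      rw [leaves_map', List.map_map]
      have := fc_shift (2 * (k + 1))
      rw [← mul_assoc] at this
      exact congrArg (fun φ => TA12.leaves.map φ) this
    simp only [TkA, PTree.leaves, List.map_append, List.toFinset_append, ih, h1, h0,
      Finset.union_self]

/-- for every `k ≥ 2` there is an optimal character `f` for
`d_MP(T^k_A, T^k_B)` using exactly 3 states which admits optimal extensions to
both trees assigning the two roots the same state. (Recall `TkA (k-1) = T^k_A`.) -/
theorem exists_optimal_three_state_same_root (k : ℕ) (hk : 2 ≤ k) :
    ∃ f : ℕ → ℕ,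
      ((pscore f (TkA (k - 1)) : ℤ) - (pscore f (TkB (k - 1)) : ℤ)).natAbs =
        dMP (TkA (k - 1)) (TkB (k - 1)) ∧
      ((TkA (k - 1)).leaves.map f).toFinset.card = 3 ∧
      ∃ gA gB : ETree ℕ,
        IsExtension f (TkA (k - 1)) gA ∧ gA.changes = pscore f (TkA (k - 1)) ∧
        IsExtension f (TkB (k - 1)) gB ∧ gB.changes = pscore f (TkB (k - 1)) ∧
        gA.root = gB.root := by
  generalize k - 1 = n
  obtain ⟨gA, hA, rA, cA⟩ := good_A n
  obtain ⟨gB, hB, rB, cB⟩ := rel_AB n fc gA hA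
  have l1 := pscore_le fc _ gA hA
  have l2 := pscore_le fc _ gB hB
  have l3 := (rel_AB n).pscore fc
  obtain ⟨g, hg, e⟩ := pscore_att fc (TkB n)
  have l4 := low_B n g hg
  have key : ((pscore fc (TkA n) : ℤ) - (pscore fc (TkB n) : ℤ)).natAbs = 4 * (n + 1) := by omega
  refine ⟨fc, ?_, ?_, gA, gB, hA, by omega, hB, by omega, rB.symm⟩
  · symm
    refine IsGreatest.csSup_eq ⟨⟨fc, rfl⟩, ?_⟩
    rintro _ ⟨f, rfl⟩
    rw [key]
    have := (rel_AB n).pscore f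
    have := (rel_BA n).pscore f
    omega
  · rw [states]; rfl

end MPDist
end

section
/- For every integer k ≥ 1, gap(T^k_AA, T^k_BB) ≥ k + 1, where gap is taken over characters using at most 2 states. -/
namespace MPDist

/-- Fitch root sets for two states: `{0}`, `{1}`, `{0,1}`. -/
inductive Q : Type
  | z | o | b
  deriving DecidableEq

instance : Fintype Q := ⟨{.z, .o, .b}, fun x => by cases x <;> decide⟩

/-- Membership of a state. -/
def Q.mem : Q → Fin 2 → Bool
  | .z, c => c = 0
  | .o, c => c = 1
  | .b, _ => true

/-- Fitch's set combination. -/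
def Q.comb : Q → Q → Q
  | .b, q => q
  | q, .b => q
  | .z, .z => .z
  | .o, .o => .o
  | .z, .o => .b
  | .o, .z => .b

/-- Fitch's increment. -/
def Q.inc : Q → Q → ℕ
  | .z, .o => 1
  | .o, .z => 1
  | _, _ => 0

def qleaf (c : Fin 2) : Q := if c = 0 then .z else .o

def fset (f : ℕ → Fin 2) : PTree ℕ → Q
  | .leaf x => qleaf (f x)
  | .node l r => (fset f l).comb (fset f r)

def fsc (f : ℕ → Fin 2) : PTree ℕ → ℕ
  | .leaf _ => 0
  | .node l r => fsc f l + fsc f r + (fset f l).inc (fset f r)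

def ind (p : Bool) : ℕ := if p then 0 else 1

lemma lower_aux : ∀ (p q : Q) (a b c : Fin 2),
    p.inc q + ind ((p.comb q).mem c) ≤
      ind (p.mem a) + ind (q.mem b) + ((if a = c then 0 else 1) + (if b = c then 0 else 1)) := by
  decide

lemma fitch_lower (f : ℕ → Fin 2) (T : PTree ℕ) (g : ETree (Fin 2)) (h : IsExtension f T g) :
    fsc f T + ind ((fset f T).mem g.root) ≤ g.changes := by
  induction h with
  | leaf x =>
    simp only [fsc, fset, ETree.root, ETree.changes]
    generalize f x = y
    revert y; decide
  | @node l r gl gr c _ _ h1 h2 =>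
    have e : (ETree.node c gl gr).root = c := rfl
    rw [e]
    simp only [fsc, fset, ETree.changes]
    have := lower_aux (fset f l) (fset f r) gl.root gr.root c
    omega

lemma upper_aux : ∀ (p q : Q) (c : Fin 2), (p.comb q).mem c = true →
    ∃ a b : Fin 2, p.mem a = true ∧ q.mem b = true ∧
      (if a = c then 0 else 1) + (if b = c then 0 else 1) = p.inc q := by
  decide

lemma fitch_upper (f : ℕ → Fin 2) (T : PTree ℕ) : ∀ c, (fset f T).mem c = true →
    ∃ g, IsExtension f T g ∧ g.root = c ∧ g.changes = fsc f T := by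
  induction T with
  | leaf x =>
    intro c hc
    refine ⟨.leaf (f x), .leaf x, ?_, rfl⟩
    simp only [fset, ETree.root] at *
    generalize f x = y at *
    revert y c; decide
  | node l r ihl ihr =>
    intro c hc
    obtain ⟨a, b, ha, hb, hab⟩ := upper_aux _ _ _ hc
    obtain ⟨gl, h1, h2, h3⟩ := ihl a ha
    obtain ⟨gr, h4, h5, h6⟩ := ihr b hb
    refine ⟨.node c gl gr, .node c h1 h4, rfl, ?_⟩
    simp only [ETree.changes, fsc, h2, h3, h5, h6]
    omega

lemma mem_ex : ∀ q : Q, ∃ c, q.mem c = true := by decide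

lemma pscore_eq (f : ℕ → Fin 2) (T : PTree ℕ) : pscore f T = fsc f T := by
  unfold pscore
  apply le_antisymm
  · obtain ⟨c, hc⟩ := mem_ex (fset f T)
    obtain ⟨g, h1, _, h3⟩ := fitch_upper f T c hc
    exact Nat.sInf_le ⟨g, h1, h3⟩
  · refine le_csInf ?_ ?_
    · obtain ⟨c, hc⟩ := mem_ex (fset f T)
      obtain ⟨g, h1, _, h3⟩ := fitch_upper f T c hc
      exact ⟨_, g, h1, h3⟩
    · rintro k ⟨g, h1, rfl⟩
      have := fitch_lower f T g h1
      omega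

lemma inc_le : ∀ p q : Q, p.inc q ≤ 1 := by decide

lemma fsc_le (f : ℕ → Fin 2) (T : PTree ℕ) : fsc f T + 1 ≤ T.leaves.length := by
  induction T with
  | leaf x => simp [fsc, PTree.leaves]
  | node l r h1 h2 =>
    simp only [fsc, PTree.leaves, List.length_append]
    have := inc_le (fset f l) (fset f r)
    omega

lemma fset_shift (f : ℕ → Fin 2) (s : ℕ) (T : PTree ℕ) :
    fset f (shiftT s T) = fset (fun x => f (x + s)) T := by
  induction T with
  | leaf x => rfl
  | node l r h1 h2 =>
    simp only [shiftT, PTree.map, fset] at *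
    rw [h1, h2]

lemma fsc_shift (f : ℕ → Fin 2) (s : ℕ) (T : PTree ℕ) :
    fsc f (shiftT s T) = fsc (fun x => f (x + s)) T := by
  induction T with
  | leaf x => rfl
  | node l r h1 h2 =>
    have e1 := fset_shift f s l
    have e2 := fset_shift f s r
    simp only [shiftT, PTree.map, fsc] at *
    rw [h1, h2, e1, e2]

/-- `lo` bounds `l_f(B) - l_f(A)` from below, by the two root sets. -/
def Bd (lo : Q → Q → ℤ) (A B : PTree ℕ) : Prop :=
  ∀ f : ℕ → Fin 2, lo (fset f A) (fset f B) ≤ (fsc f B : ℤ) - fsc f A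

lemma Bd.shift {lo A B} (h : Bd lo A B) (s : ℕ) : Bd lo (shiftT s A) (shiftT s B) := by
  intro f
  rw [fset_shift, fset_shift, fsc_shift, fsc_shift]
  exact h _

lemma Bd.node {lo lo1 lo2 A B A' B'} (h1 : Bd lo1 A B) (h2 : Bd lo2 A' B')
    (h : ∀ p q p' q', lo (p.comb p') (q.comb q') ≤
      lo1 p q + lo2 p' q' + (q.inc q' : ℤ) - (p.inc p' : ℤ)) :
    Bd lo (.node A A') (.node B B') := by
  intro f
  have a1 := h1 f
  have a2 := h2 f
  have a3 := h (fset f A) (fset f B) (fset f A') (fset f B')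
  simp only [fset, fsc]
  push_cast
  linarith

def loa : Q → Q → ℤ
  | .z, .o => 0
  | .o, .z => 0
  | _, _ => -2

def loA : Q → Q → ℤ
  | .b, _ => -5
  | _, _ => -4

def loAA : Q → Q → ℤ
  | .b, _ => -10
  | _, _ => -9

set_option maxRecDepth 100000 in
lemma bd8 : Bd loa Ta8 Tb8 := by
  intro f
  simp only [Ta8, Tb8, fset, fsc]
  generalize f 0 = x0
  generalize f 1 = x1
  generalize f 2 = x2
  generalize f 3 = x3
  generalize f 4 = x4
  generalize f 5 = x5
  generalize f 6 = x6
  generalize f 7 = x7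
  revert x0 x1 x2 x3 x4 x5 x6 x7
  decide +kernel

lemma bd16 : Bd loA TA16 TB16 := bd8.node (bd8.shift 8) (by decide +kernel)

lemma bd32 : Bd loAA TAA TBB := bd16.node (bd16.shift 16) (by decide +kernel)

lemma loAA_step : ∀ p q p' q', loAA (p.comb p') (q.comb q') ≤
      loAA p q + loAA p' q' + (q.inc q' : ℤ) - (p.inc p' : ℤ) + 10 := by decide +kernel

lemma bdk (k : ℕ) : Bd (fun p q => loAA p q - 10 * k) (TkAA k) (TkBB k) := by
  induction k with
  | zero => simpa [TkAA, TkBB] using bd32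
  | succ k ih =>
    refine ih.node (bd32.shift (32 * (k + 1))) ?_
    intro p q p' q'
    have := loAA_step p q p' q'
    push_cast
    linarith

lemma loAA_ge : ∀ p q, -10 ≤ loAA p q := by decide

/-- The periodic witness character. -/
def wit (x : ℕ) : Fin 2 := if x % 8 = 2 ∨ x % 8 = 3 ∨ x % 8 = 4 ∨ x % 8 = 5 then 1 else 0

/-- Both root sets full and score difference `d` under the witness. -/
def Wt (d : ℤ) (A B : PTree ℕ) : Prop :=
  fset wit A = .b ∧ fset wit B = .b ∧ (fsc wit B : ℤ) - fsc wit A = d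

lemma wit_shift (s : ℕ) : (fun x => wit (x + 8 * s)) = wit := by
  funext x
  simp [wit, Nat.add_mul_mod_self_left]

lemma Wt.shift {d A B} (h : Wt d A B) (s : ℕ) : Wt d (shiftT (8 * s) A) (shiftT (8 * s) B) := by
  unfold Wt
  rw [fset_shift, fset_shift, fsc_shift, fsc_shift, wit_shift]
  exact h

lemma Wt.node {d d' A B A' B'} (h1 : Wt d A B) (h2 : Wt d' A' B') :
    Wt (d + d') (.node A A') (.node B B') := by
  obtain ⟨a1, a2, a3⟩ := h1
  obtain ⟨b1, b2, b3⟩ := h2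
  refine ⟨?_, ?_, ?_⟩
  · simp [fset, a1, b1, Q.comb]
  · simp [fset, a2, b2, Q.comb]
  · simp only [fsc, a1, a2, b1, b2, Q.inc]
    push_cast
    linarith

lemma wt8 : Wt 3 Ta8 Tb8 := by
  refine ⟨?_, ?_, ?_⟩ <;> decide +kernel

lemma wt16 : Wt 6 TA16 TB16 := wt8.node (wt8.shift 1)

lemma wt32 : Wt 12 TAA TBB := wt16.node (wt16.shift 2)

lemma wtk (k : ℕ) : Wt (12 * (k + 1)) (TkAA k) (TkBB k) := by
  induction k with
  | zero => simpa [TkAA, TkBB] using wt32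
  | succ k ih =>
    have h := ih.node (wt32.shift (4 * (k + 1)))
    have e : 8 * (4 * (k + 1)) = 32 * (k + 1) := by ring
    rw [e] at h
    have e2 : (12 * (((k + 1 : ℕ) : ℤ) + 1)) = 12 * ((k : ℤ) + 1) + 12 := by push_cast; ring
    rw [e2]
    exact h

lemma gap_main (k : ℕ) : (k + 2 : ℤ) ≤ gapk 2 (TkAA k) (TkBB k) := by
  have h1 : (12 * (k + 1) : ℤ) ≤ maxDiffk 2 (TkAA k) (TkBB k) := by
    refine le_csSup ⟨((TkBB k).leaves.length : ℤ), ?_⟩ ⟨wit, ?_⟩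
    · rintro d ⟨f, rfl⟩
      rw [pscore_eq, pscore_eq]
      have := fsc_le f (TkBB k)
      omega
    · rw [pscore_eq, pscore_eq]
      exact (wtk k).2.2.symm
  have h2 : maxDiffk 2 (TkBB k) (TkAA k) ≤ 10 * (k + 1) := by
    refine csSup_le ⟨_, fun _ => 0, rfl⟩ ?_
    rintro d ⟨f, rfl⟩
    rw [pscore_eq, pscore_eq]
    have a := bdk k f
    have b := loAA_ge (fset f (TkAA k)) (fset f (TkBB k))
    simp only at a
    linarith
  unfold gapk
  refine le_trans ?_ (le_abs_self _)
  have : (0 : ℤ) ≤ k := Int.natCast_nonneg k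
  linarith

/-- for every `k ≥ 1`, `gap(T^k_AA, T^k_BB) ≥ k + 1`, where the
gap is taken over characters with at most 2 states.
(Recall `TkAA (k-1) = T^k_AA`.) -/
theorem gap_TkAA_TkBB (k : ℕ) (hk : 1 ≤ k) :
    (k + 1 : ℤ) ≤ gapk 2 (TkAA (k - 1)) (TkBB (k - 1)) := by
  obtain ⟨m, rfl⟩ := Nat.exists_eq_add_of_le' hk
  have := gap_main m
  simp only [Nat.add_sub_cancel]
  push_cast
  linarith

end MPDist
end
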